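/- Let n be a positive integer and let x ∈ (a,b) with 1/n ≤ a < b < ∞, and set α = ⌊na⌋/n and β = ⌈nb⌉/n. Suppose f, ℓ : [0,∞) → ℝ are functions such that ℓ is affine and f(t) = ℓ(t) for all t ∈ (a,b). If E|f|^p(N_{nx}/n) < ∞ for some p > 1, then |S_n f(x) − f(x)| ≤ (E|f − ℓ|^p(N_{nx}/n))^{1/p} · ( L_n(x,α)^{1/q}·exp(−n·H(α,x)/q) + R_n(x,β)^{1/q}·exp(−n·H(β,x)/q) ), where 1/p + 1/q = 1. -/

import Mathlib

open Real

/-- Poisson probability mass function with mean `lam`: `P(N_lam = k)`. -/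
noncomputable def poissonProb (lam : ℝ) (k : ℕ) : ℝ := lam ^ k * Real.exp (-lam) / k.factorial

/-- Kullback–Leibler divergence between Poisson random variables with means `t` and `x`. -/
noncomputable def H (t x : ℝ) : ℝ := t * Real.log (t / x) - t + x

/-- The Szász–Mirakyan operator: `S_n f x = E f(N_{nx}/n)`. -/
noncomputable def szasz (n : ℕ) (f : ℝ → ℝ) (x : ℝ) : ℝ :=
  ∑' k : ℕ, f ((k : ℝ) / n) * poissonProb ((n : ℝ) * x) k

/-- `L_n(x,α)` from the left-tail bound. -/
noncomputable def Ln (n : ℕ) (x α : ℝ) : ℝ :=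
  min (x / ((x - α + 1 / n) * Real.sqrt (2 * π * n * α))) (1 / 2) + 1 / Real.sqrt (2 * π * n * α)

/-- `R_n(x,β)` from the right-tail bound. -/
noncomputable def Rn (n : ℕ) (x β : ℝ) : ℝ :=
  min (x / ((β - x + 1 / n) * Real.sqrt (2 * π * n * β))) (1 / 2) + 1 / Real.sqrt (2 * π * n * β)

theorem poissonProb_nonneg {lam : ℝ} (h : 0 ≤ lam) (k : ℕ) : 0 ≤ poissonProb lam k := by
  unfold poissonProb; positivity

theorem poissonProb_succ (lam : ℝ) (k : ℕ) :
    poissonProb lam (k + 1) = poissonProb lam k * lam / (k + 1) := by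
  unfold poissonProb
  rw [Nat.factorial_succ, Nat.cast_mul, Nat.cast_succ, pow_succ]
  field_simp

theorem hasSum_poissonProb (lam : ℝ) : HasSum (poissonProb lam) 1 := by
  convert! (NormedSpace.expSeries_div_hasSum_exp lam).mul_left (exp (-lam)) using 1
  · funext k; unfold poissonProb; ring
  · simp [← exp_eq_exp_ℝ, ← exp_add]

theorem hasSum_natCast_mul_poissonProb (lam : ℝ) :
    HasSum (fun k : ℕ => (k : ℝ) * poissonProb lam k) lam := by
  rw [← hasSum_nat_add_iff' 1]
  have h : (fun k : ℕ => ((k + 1 : ℕ) : ℝ) * poissonProb lam (k + 1)) =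
      fun k => lam * poissonProb lam k := by
    funext k
    rw [poissonProb_succ, Nat.cast_succ]
    field_simp
  rw [h]
  simpa using (hasSum_poissonProb lam).mul_left lam

theorem summable_exp_mul_poissonProb (c lam : ℝ) :
    Summable fun k : ℕ => exp (c * k) * poissonProb lam k := by
  refine ((Real.summable_pow_div_factorial (lam * exp c)).mul_left (exp (-lam))).congr fun k => ?_
  rw [poissonProb, mul_pow, ← Real.exp_nat_mul, mul_comm c]
  ring

/-- Change of the mean of a Poisson distribution. -/
theorem poissonProb_eq_tilt {lam m : ℝ} (hm : m ≠ 0) (k : ℕ) :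
    poissonProb lam k = poissonProb m k * ((lam / m) ^ k * exp (m - lam)) := by
  have h : exp (-lam) = exp (-m) * exp (m - lam) := by rw [← exp_add]; ring_nf
  rw [poissonProb, poissonProb, div_pow, h]
  field_simp

theorem exp_neg_H_natCast {lam : ℝ} {m : ℕ} (hm : 0 < m) (hlam : 0 < lam) :
    exp (-H m lam) = (lam / m) ^ m * exp (m - lam) := by
  have hm' : (0 : ℝ) < m := by exact_mod_cast hm
  rw [H, show -((m : ℝ) * log (m / lam) - m + lam) = m * log (lam / m) + (m - lam) by
    rw [← inv_div lam (m : ℝ), log_inv]; ring]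
  rw [exp_add, Real.exp_nat_mul, exp_log (by positivity)]

theorem poissonProb_self_le (m : ℕ) (hm : 0 < m) : poissonProb m m ≤ 1 / √(2 * π * m) := by
  have hm' : (0 : ℝ) < m := by exact_mod_cast hm
  have h := Stirling.le_factorial_stirling m
  rw [div_pow, ← Real.exp_nat_mul, mul_one] at h
  rw [poissonProb, exp_neg, div_le_div_iff₀ (by positivity) (by positivity)]
  calc _ = √(2 * π * m) * ((m : ℝ) ^ m / exp m) := by ring
    _ ≤ _ := by linarith

/-- Local bound on the Poisson probabilities. -/
theorem poissonProb_le {lam : ℝ} {m : ℕ} (hm : 0 < m) (hlam : 0 < lam) :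
    poissonProb lam m ≤ 1 / √(2 * π * m) * exp (-H m lam) := by
  have hm' : (m : ℝ) ≠ 0 := by exact_mod_cast hm.ne'
  rw [poissonProb_eq_tilt hm', exp_neg_H_natCast hm hlam]
  exact mul_le_mul_of_nonneg_right (poissonProb_self_le m hm) (by positivity)

theorem poissonProb_self_reflect_le (m j : ℕ) :
    ∀ i, i + j + 1 = m → poissonProb m i ≤ poissonProb m (m + j) := by
  induction j with
  | zero =>
    rintro i rfl
    rw [show i + 0 + 1 + 0 = i + 1 by ring, poissonProb_succ]
    apply le_of_eq
    push_cast
    field_simp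
  | succ j ih =>
    intro i hi
    have h := ih (i + 1) (by omega)
    have hm : (m : ℝ) = i + j + 2 := by rw [← hi]; push_cast; ring
    have h0 := poissonProb_nonneg (Nat.cast_nonneg (α := ℝ) m) i
    rw [poissonProb_succ] at h
    rw [← add_assoc, poissonProb_succ]
    refine le_trans ?_ (div_le_div_of_nonneg_right
      (mul_le_mul_of_nonneg_right h (Nat.cast_nonneg _)) (by positivity))
    rw [le_div_iff₀ (by positivity), div_mul_eq_mul_div, le_div_iff₀ (by positivity), mul_assoc,
      mul_assoc]
    refine mul_le_mul_of_nonneg_left ?_ h0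
    push_cast
    rw [hm]
    nlinarith [sq_nonneg ((j : ℝ) + 1)]

/-- The median of a Poisson distribution with integer mean `m` is at least `m`. -/
theorem sum_range_poissonProb_self_le_half (m : ℕ) :
    ∑ k ∈ Finset.range m, poissonProb m k ≤ 1 / 2 := by
  have h1 : ∑ k ∈ Finset.range m, poissonProb m k ≤
      ∑ j ∈ Finset.range m, poissonProb m (m + j) := by
    rw [← Finset.sum_range_reflect]
    refine Finset.sum_le_sum fun j hj => poissonProb_self_reflect_le m j _ ?_
    rw [Finset.mem_range] at hj
    omega
  have h2 : ∑ k ∈ Finset.range (m + m), poissonProb m k ≤ 1 :=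
    sum_le_hasSum _ (fun k _ => poissonProb_nonneg (Nat.cast_nonneg _) k) (hasSum_poissonProb m)
  rw [Finset.sum_range_add] at h2
  linarith

theorem hasDerivAt_sum_range_poissonProb (m : ℕ) (t : ℝ) :
    HasDerivAt (fun t => ∑ k ∈ Finset.range (m + 1), poissonProb t k) (-poissonProb t m) t := by
  induction m with
  | zero =>
    simp only [zero_add, Finset.sum_range_one, poissonProb, pow_zero, one_mul, Nat.factorial_zero,
      Nat.cast_one, div_one]
    simpa using (hasDerivAt_neg t).exp
  | succ m ih =>
    rw [funext fun t => Finset.sum_range_succ (poissonProb t) (m + 1)]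
    have h : HasDerivAt (fun t => poissonProb t (m + 1))
        (poissonProb t m - poissonProb t (m + 1)) t := by
      unfold poissonProb
      convert! ((hasDerivAt_pow (m + 1) t).mul (hasDerivAt_neg t).exp).div_const
        ((m + 1).factorial : ℝ) using 1
      rw [Nat.factorial_succ]
      push_cast
      field_simp
      ring
    convert! ih.add h using 1
    ring

theorem poissonProb_sub_le_add {m : ℕ} {s : ℝ} (hs : 0 ≤ s) (hsm : s < m) :
    poissonProb (m - s) m ≤ poissonProb (m + s) m := by
  have hm : (0 : ℝ) < m := hs.trans_lt hsm
  have hu : |s / m| < 1 := by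
    rw [abs_of_nonneg (by positivity), div_lt_one hm]; exact hsm
  have hlog : 2 * (s / m) ≤ log (1 + s / m) - log (1 - s / m) := by
    have h := sum_le_hasSum {0} (fun k _ => by positivity) (hasSum_log_sub_log_of_abs_lt_one hu)
    simpa using h
  have h1 : (m : ℝ) - s = m * (1 - s / m) := by field_simp
  have h2 : (m : ℝ) + s = m * (1 + s / m) := by field_simp
  have hp1 : 0 < 1 - s / m := sub_pos.2 (lt_of_abs_lt hu)
  have hp2 : 0 < 1 + s / m := by positivity
  have key : (m - s) ^ m * exp (-(m - s)) ≤ (m + s) ^ m * exp (-(m + s)) := by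
    rw [h1, h2, mul_pow, mul_pow, mul_assoc, mul_assoc]
    refine mul_le_mul_of_nonneg_left ?_ (by positivity)
    rw [← h1, ← h2]
    nth_rw 1 [← exp_log hp1]
    nth_rw 1 [← exp_log hp2]
    rw [← Real.exp_nat_mul, ← Real.exp_nat_mul, ← exp_add, ← exp_add, exp_le_exp]
    have h3 := mul_le_mul_of_nonneg_left hlog hm.le
    have h4 : (m : ℝ) * (2 * (s / m)) = 2 * s := by field_simp
    linarith
  exact div_le_div_of_nonneg_right key (by positivity)

/-- The median of a Poisson distribution with integer mean `m` is at most `m`. -/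
theorem half_le_sum_range_succ_poissonProb_self (m : ℕ) :
    1 / 2 ≤ ∑ k ∈ Finset.range (m + 1), poissonProb m k := by
  set F : ℝ → ℝ := fun t => ∑ k ∈ Finset.range (m + 1), poissonProb t k with hF
  have hd (s : ℝ) : HasDerivAt (fun s => F (m - s) + F (m + s))
      (poissonProb (m - s) m - poissonProb (m + s) m) s := by
    have h1 := (hasDerivAt_sum_range_poissonProb m (m - s)).comp s
      ((hasDerivAt_id s).const_sub (m : ℝ))
    have h2 := (hasDerivAt_sum_range_poissonProb m (m + s)).comp s
      ((hasDerivAt_id s).const_add (m : ℝ))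
    convert! h1.add h2 using 1
    ring
  have hanti : AntitoneOn (fun s => F (m - s) + F (m + s)) (Set.Icc 0 (m : ℝ)) := by
    refine antitoneOn_of_deriv_nonpos (convex_Icc _ _)
      (fun s _ => (hd s).continuousAt.continuousWithinAt)
      (fun s _ => (hd s).differentiableAt.differentiableWithinAt) fun s hs => ?_
    rw [interior_Icc] at hs
    rw [(hd s).deriv]
    exact sub_nonpos.2 (poissonProb_sub_le_add hs.1.le hs.2)
  have hm : (0 : ℝ) ≤ m := Nat.cast_nonneg m
  have h := hanti (Set.left_mem_Icc.2 hm) (Set.right_mem_Icc.2 hm) hm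
  have h0 : F 0 = 1 := by
    simp [hF, Finset.sum_range_succ', poissonProb]
  have h2 : 0 ≤ F (m + m) := Finset.sum_nonneg fun k _ => poissonProb_nonneg (by positivity) k
  simp only [sub_self, sub_zero, add_zero, h0] at h
  change 1 / 2 ≤ F m
  linarith

theorem sum_range_poissonProb_le {lam : ℝ} (hlam : 0 < lam) (m : ℕ) (hm : (m : ℝ) < lam + 1) :
    ∑ k ∈ Finset.range m, poissonProb lam k ≤ poissonProb lam m * (m / (lam - m + 1)) := by
  induction m with
  | zero => simp
  | succ m ih =>
    push_cast at hm
    have h1 : 0 < lam - m := by linarith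
    have h0 := poissonProb_nonneg hlam.le m
    rw [Finset.sum_range_succ, poissonProb_succ]
    refine (add_le_add_left (ih (by linarith)) _).trans ?_
    have e1 : poissonProb lam m * (m / (lam - m + 1)) + poissonProb lam m =
        poissonProb lam m * ((lam + 1) / (lam - m + 1)) := by field_simp; ring
    have e2 : poissonProb lam m * lam / (m + 1) * (((m + 1 : ℕ) : ℝ) / (lam - (m + 1 : ℕ) + 1)) =
        poissonProb lam m * (lam / (lam - m)) := by
      push_cast
      rw [show lam - (m + 1) + 1 = lam - m by ring]
      field_simp
    rw [e1, e2]
    refine mul_le_mul_of_nonneg_left ?_ h0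
    rw [div_le_div_iff₀ (by linarith) h1]
    nlinarith [Nat.cast_nonneg (α := ℝ) m]

theorem summable_poissonProb_nat_add (lam : ℝ) (j : ℕ) :
    Summable fun k => poissonProb lam (k + j) :=
  (summable_nat_add_iff j).2 (hasSum_poissonProb lam).summable

theorem tsum_poissonProb_nat_add_le {lam : ℝ} (hlam : 0 < lam) (m : ℕ) (hm : lam < m + 1) :
    ∑' k, poissonProb lam (k + (m + 1)) ≤ poissonProb lam m * (lam / (m - lam + 1)) := by
  set r : ℝ := lam / (m + 1) with hr
  have hr0 : 0 ≤ r := by positivity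
  have hr1 : r < 1 := by rw [hr, div_lt_one (by positivity)]; exact hm
  have hpt (k : ℕ) : poissonProb lam (k + (m + 1)) ≤ poissonProb lam m * r * r ^ k := by
    induction k with
    | zero =>
      rw [zero_add, poissonProb_succ, pow_zero, mul_one, hr, mul_div_assoc]
    | succ k ih =>
      rw [show k + 1 + (m + 1) = k + (m + 1) + 1 by ring, poissonProb_succ, pow_succ, ← mul_assoc,
        mul_div_assoc]
      refine mul_le_mul ih ?_ (by positivity) ?_
      · rw [hr]; gcongr; linarith [Nat.cast_nonneg (α := ℝ) k]
      · have := poissonProb_nonneg hlam.le m; positivity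
  have hg := (hasSum_geometric_of_lt_one hr0 hr1).mul_left (poissonProb lam m * r)
  refine ((summable_poissonProb_nat_add lam (m + 1)).tsum_le_tsum hpt hg.summable).trans_eq ?_
  have h1 : (m : ℝ) - lam + 1 ≠ 0 := by linarith
  have h2 : 1 - r = (m - lam + 1) / (m + 1) := by rw [hr]; field_simp; ring
  rw [hg.tsum_eq, h2, hr]
  field_simp

/-- Left tail bound for the Poisson distribution. -/
theorem sum_range_succ_poissonProb_le {lam : ℝ} {m : ℕ} (hm : 0 < m) (hlam : (m : ℝ) ≤ lam) :
    ∑ k ∈ Finset.range (m + 1), poissonProb lam k ≤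
      (min (lam / ((lam - m + 1) * √(2 * π * m))) (1 / 2) + 1 / √(2 * π * m)) *
        exp (-H m lam) := by
  have hm' : (0 : ℝ) < m := by exact_mod_cast hm
  have hl : 0 < lam := hm'.trans_le hlam
  have hd : 0 < lam - m + 1 := by linarith
  rw [Finset.sum_range_succ, add_mul]
  refine add_le_add ?_ (poissonProb_le hm hl)
  rw [min_mul_of_nonneg _ _ (exp_pos _).le]
  refine le_min ?_ ?_
  · calc _ ≤ poissonProb lam m * (m / (lam - m + 1)) :=
          sum_range_poissonProb_le hl m (by linarith)
      _ ≤ 1 / √(2 * π * m) * exp (-H m lam) * (lam / (lam - m + 1)) := by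
          gcongr
          exact poissonProb_le hm hl
      _ = _ := by field_simp
  · rw [exp_neg_H_natCast hm hl]
    refine le_trans ?_ (mul_le_mul_of_nonneg_right (sum_range_poissonProb_self_le_half m)
      (by positivity))
    rw [Finset.sum_mul]
    refine Finset.sum_le_sum fun k hk => ?_
    rw [poissonProb_eq_tilt hm'.ne']
    have h0 := poissonProb_nonneg hm'.le k
    gcongr
    · rwa [one_le_div hm']
    · exact (Finset.mem_range.1 hk).le

/-- Right tail bound for the Poisson distribution. -/
theorem tsum_poissonProb_nat_add_self_le {lam : ℝ} {m : ℕ} (hm : 0 < m) (hl : 0 < lam)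
    (hlam : lam ≤ m) :
    ∑' k, poissonProb lam (k + m) ≤
      (min (lam / ((m - lam + 1) * √(2 * π * m))) (1 / 2) + 1 / √(2 * π * m)) *
        exp (-H m lam) := by
  have hm' : (0 : ℝ) < m := by exact_mod_cast hm
  have hd : 0 < m - lam + 1 := by linarith
  rw [(summable_poissonProb_nat_add lam m).tsum_eq_zero_add, zero_add, add_comm, add_mul]
  simp only [add_assoc, add_comm 1 m]
  refine add_le_add ?_ (poissonProb_le hm hl)
  rw [min_mul_of_nonneg _ _ (exp_pos _).le]
  refine le_min ?_ ?_
  · calc _ ≤ poissonProb lam m * (lam / (m - lam + 1)) :=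
          tsum_poissonProb_nat_add_le hl m (by linarith)
      _ ≤ 1 / √(2 * π * m) * exp (-H m lam) * (lam / (m - lam + 1)) := by
          gcongr
          exact poissonProb_le hm hl
      _ = _ := by field_simp
  · have hmed : ∑' k, poissonProb m (k + (m + 1)) ≤ 1 / 2 := by
      have h := (hasSum_poissonProb m).summable.sum_add_tsum_nat_add (m + 1)
      rw [(hasSum_poissonProb m).tsum_eq] at h
      linarith [half_le_sum_range_succ_poissonProb_self m]
    rw [exp_neg_H_natCast hm hl]
    refine le_trans ?_ (mul_le_mul_of_nonneg_right hmed (by positivity))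
    rw [← tsum_mul_right]
    refine (summable_poissonProb_nat_add lam (m + 1)).tsum_le_tsum (fun k => ?_)
      ((summable_poissonProb_nat_add m (m + 1)).mul_right _)
    rw [poissonProb_eq_tilt hm'.ne']
    have h0 := poissonProb_nonneg hm'.le (k + (m + 1))
    refine mul_le_mul_of_nonneg_left (mul_le_mul_of_nonneg_right ?_ (exp_pos _).le) h0
    exact pow_le_pow_of_le_one (by positivity) ((div_le_one hm').2 hlam) (by omega)

theorem abs_sub_rpow_le {p : ℝ} (hp : 1 ≤ p) (u v : ℝ) :
    |u - v| ^ p ≤ 2 ^ (p - 1) * (|u| ^ p + |v| ^ p) := by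
  refine (rpow_le_rpow (abs_nonneg _) (abs_sub u v) (by linarith)).trans ?_
  exact_mod_cast NNReal.rpow_add_le_mul_rpow_add_rpow ⟨|u|, abs_nonneg u⟩ ⟨|v|, abs_nonneg v⟩ hp

/-- Affine sequences have finite absolute Poisson moments. -/
theorem summable_abs_affine_rpow_mul_poissonProb {lam p : ℝ} (hlam : 0 ≤ lam) (hp : 0 ≤ p)
    (c d : ℝ) : Summable fun k : ℕ => |c * k + d| ^ p * poissonProb lam k := by
  refine Summable.of_nonneg_of_le
    (fun k => mul_nonneg (by positivity) (poissonProb_nonneg hlam k)) (fun k => ?_)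
    ((summable_exp_mul_poissonProb (|c| * p) lam).mul_left (exp (|d| * p)))
  rw [← mul_assoc]
  refine mul_le_mul_of_nonneg_right ?_ (poissonProb_nonneg hlam k)
  have h1 : |c * k + d| ≤ exp (|c| * k + |d|) := by
    have h := abs_add_le (c * k) d
    rw [abs_mul, Nat.abs_cast] at h
    linarith [add_one_le_exp (|c| * k + |d|)]
  refine (rpow_le_rpow (abs_nonneg _) h1 hp).trans_eq ?_
  rw [← exp_mul, ← exp_add]
  ring_nf

/-- Hölder's inequality for a Poisson expectation restricted to an event. -/
theorem summable_and_tsum_indicator_mul_poissonProb_le {lam p q : ℝ} (hlam : 0 ≤ lam)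
    (hpq : p.HolderConjugate q) (g : ℕ → ℝ) (s : Set ℕ)
    (hg : Summable fun k => |g k| ^ p * poissonProb lam k) :
    (Summable fun k => s.indicator (fun k => |g k| * poissonProb lam k) k) ∧
      ∑' k, s.indicator (fun k => |g k| * poissonProb lam k) k ≤
        (∑' k, |g k| ^ p * poissonProb lam k) ^ (1 / p) *
          (∑' k, s.indicator (poissonProb lam) k) ^ (1 / q) := by
  have hP := poissonProb_nonneg hlam
  have hp := hpq.pos
  have hq := hpq.symm.pos
  set u : ℕ → ℝ := fun k => |g k| * poissonProb lam k ^ (1 / p) with hu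
  set v : ℕ → ℝ := s.indicator fun k => poissonProb lam k ^ (1 / q) with hv
  have hup : (fun k => u k ^ p) = fun k => |g k| ^ p * poissonProb lam k := by
    funext k
    rw [hu, mul_rpow (abs_nonneg _) (rpow_nonneg (hP k) _), ← rpow_mul (hP k),
      one_div_mul_cancel hp.ne', rpow_one]
  have hvq : (fun k => v k ^ q) = s.indicator (poissonProb lam) := by
    funext k
    by_cases hk : k ∈ s
    · simp only [hv, Set.indicator_of_mem hk]
      rw [← rpow_mul (hP k), one_div_mul_cancel hq.ne', rpow_one]
    · simp only [hv, Set.indicator_of_notMem hk, zero_rpow hq.ne']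
  have huv : (fun k => u k * v k) = s.indicator fun k => |g k| * poissonProb lam k := by
    funext k
    by_cases hk : k ∈ s
    · simp only [hu, hv, Set.indicator_of_mem hk]
      rw [mul_assoc, ← rpow_add_of_nonneg (hP k) (by positivity) (by positivity), one_div, one_div,
        hpq.inv_add_inv_eq_one, rpow_one]
    · simp only [hv, Set.indicator_of_notMem hk, mul_zero]
  have hv0 : ∀ k, 0 ≤ v k := fun k =>
    Set.indicator_nonneg (fun k _ => rpow_nonneg (hP k) _) k
  have hu0 : ∀ k, 0 ≤ u k := fun k => mul_nonneg (abs_nonneg _) (rpow_nonneg (hP k) _)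
  have h := summable_and_inner_le_Lp_mul_Lq_tsum_of_nonneg hpq hu0 hv0 (hup ▸ hg)
    (by rw [hvq]; exact (hasSum_poissonProb lam).summable.indicator s)
  rwa [huv, hup, hvq] at h

/-- Bound on a Poisson expectation of a sequence vanishing strictly between `m` and `M`. -/
theorem abs_tsum_mul_poissonProb_le {lam p q : ℝ} (hlam : 0 < lam) (hpq : p.HolderConjugate q)
    {m M : ℕ} (hm : 0 < m) (hml : (m : ℝ) ≤ lam) (hlM : lam ≤ M) (g : ℕ → ℝ)
    (hg0 : ∀ k, m < k → k < M → g k = 0)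
    (hg : Summable fun k => |g k| ^ p * poissonProb lam k) :
    (Summable fun k => g k * poissonProb lam k) ∧
      |∑' k, g k * poissonProb lam k| ≤ (∑' k, |g k| ^ p * poissonProb lam k) ^ (1 / p) *
        (((min (lam / ((lam - m + 1) * √(2 * π * m))) (1 / 2) + 1 / √(2 * π * m)) *
            exp (-H m lam)) ^ (1 / q) +
          ((min (lam / ((M - lam + 1) * √(2 * π * M))) (1 / 2) + 1 / √(2 * π * M)) *
            exp (-H M lam)) ^ (1 / q)) := by
  have hP := poissonProb_nonneg hlam.le
  have hM : 0 < M := by exact_mod_cast hlam.trans_le hlM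
  have hq : 0 ≤ 1 / q := by have := hpq.symm.pos; positivity
  obtain ⟨hs1, h1⟩ := summable_and_tsum_indicator_mul_poissonProb_le hlam.le hpq g
    (Finset.range (m + 1)) hg
  obtain ⟨hs2, h2⟩ := summable_and_tsum_indicator_mul_poissonProb_le hlam.le hpq g (Set.Ici M) hg
  have hL : ∑' k, (Finset.range (m + 1) : Set ℕ).indicator (poissonProb lam) k ≤ _ :=
    (sum_eq_tsum_indicator _ _).symm.trans_le (sum_range_succ_poissonProb_le hm hml)
  have hR : ∑' k, (Set.Ici M).indicator (poissonProb lam) k =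
      ∑' k, poissonProb lam (k + M) := by
    rw [← ((hasSum_poissonProb lam).summable.indicator _).sum_add_tsum_nat_add M,
      Finset.sum_eq_zero, zero_add]
    · simp
    · intro k hk
      rw [Set.indicator_of_notMem]
      simpa using hk
  have hle (k : ℕ) : ‖g k * poissonProb lam k‖ ≤
      (Finset.range (m + 1) : Set ℕ).indicator (fun k => |g k| * poissonProb lam k) k +
        (Set.Ici M).indicator (fun k => |g k| * poissonProb lam k) k := by
    have hnn : ∀ k, 0 ≤ |g k| * poissonProb lam k := fun k => mul_nonneg (abs_nonneg _) (hP k)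
    rw [norm_mul, norm_eq_abs, norm_of_nonneg (hP k)]
    by_cases hk1 : k ≤ m
    · rw [Set.indicator_of_mem (by simpa [Nat.lt_succ_iff] using hk1)]
      exact le_add_of_nonneg_right (Set.indicator_nonneg (fun k _ => hnn k) k)
    by_cases hk2 : M ≤ k
    · rw [Set.indicator_of_mem (Set.mem_Ici.2 hk2)]
      exact le_add_of_nonneg_left (Set.indicator_nonneg (fun k _ => hnn k) k)
    rw [hg0 k (by omega) (by omega), abs_zero, zero_mul]
    exact add_nonneg (Set.indicator_nonneg (fun k _ => hnn k) k)
      (Set.indicator_nonneg (fun k _ => hnn k) k)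
  refine ⟨Summable.of_norm_bounded (hs1.add hs2) hle, ?_⟩
  refine (tsum_of_norm_bounded (hs1.add hs2).hasSum hle).trans ?_
  rw [hs1.tsum_add hs2, mul_add]
  have hA : 0 ≤ (∑' k, |g k| ^ p * poissonProb lam k) ^ (1 / p) :=
    rpow_nonneg (tsum_nonneg fun k => mul_nonneg (rpow_nonneg (abs_nonneg _) _) (hP k)) _
  refine add_le_add (h1.trans ?_) (h2.trans ?_)
  · exact mul_le_mul_of_nonneg_left (rpow_le_rpow
      (tsum_nonneg fun k => Set.indicator_nonneg (fun k _ => hP k) k) hL hq) hA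
  · exact mul_le_mul_of_nonneg_left (rpow_le_rpow
      (tsum_nonneg fun k => Set.indicator_nonneg (fun k _ => hP k) k)
      (hR.trans_le (tsum_poissonProb_nat_add_self_le hM hlam hlM)) hq) hA

/-- The Szász–Mirakyan operator reproduces affine functions. -/
theorem hasSum_affine_mul_poissonProb {n : ℕ} (hn : 0 < n) (x c d : ℝ) :
    HasSum (fun k : ℕ => (c * ((k : ℝ) / n) + d) * poissonProb (n * x) k) (c * x + d) := by
  have hn' : (n : ℝ) ≠ 0 := by exact_mod_cast hn.ne'
  convert! ((hasSum_natCast_mul_poissonProb (n * x)).mul_left (c / n)).add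
    ((hasSum_poissonProb (n * x)).mul_left d) using 1
  · funext k; ring
  · field_simp

theorem natCast_mul_H {n : ℕ} (hn : 0 < n) (t x : ℝ) : n * H t x = H (n * t) (n * x) := by
  have hn' : (n : ℝ) ≠ 0 := by exact_mod_cast hn.ne'
  rw [H, H, mul_div_mul_left _ _ hn']
  ring

theorem rpow_mul_exp_neg_H {A q x t : ℝ} {n m : ℕ} (hn : 0 < n) (hA : 0 ≤ A)
    (hm : (m : ℝ) = n * t) :
    (A * exp (-H m (n * x))) ^ (1 / q) = A ^ (1 / q) * exp (-(n : ℝ) * H t x / q) := by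
  rw [mul_rpow hA (exp_pos _).le, ← exp_mul, hm, ← natCast_mul_H hn]
  ring_nf

theorem szasz_locally_affine_rate (n : ℕ) (hn : 0 < n) (a b x : ℝ)
    (ha : 1 / n ≤ a) (hab : a < b) (hax : a < x) (hxb : x < b)
    (α β : ℝ) (hα : α = (⌊(n : ℝ) * a⌋ : ℝ) / n) (hβ : β = (⌈(n : ℝ) * b⌉ : ℝ) / n)
    (f ℓ : ℝ → ℝ) (hℓ : ∃ c d : ℝ, ∀ t : ℝ, 0 ≤ t → ℓ t = c * t + d)
    (hfℓ : ∀ t : ℝ, a < t → t < b → f t = ℓ t)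
    (p q : ℝ) (hp : 1 < p) (hpq : 1 / p + 1 / q = 1)
    (hint : Summable fun k : ℕ => |f ((k : ℝ) / n)| ^ p * poissonProb ((n : ℝ) * x) k) :
    |szasz n f x - f x| ≤
      (∑' k : ℕ, |f ((k : ℝ) / n) - ℓ ((k : ℝ) / n)| ^ p * poissonProb ((n : ℝ) * x) k) ^ (1 / p)
        * (Ln n x α ^ (1 / q) * Real.exp (-(n : ℝ) * H α x / q)
          + Rn n x β ^ (1 / q) * Real.exp (-(n : ℝ) * H β x / q)) := by
  obtain ⟨c, d, hcd⟩ := hℓ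
  have hn' : (0 : ℝ) < n := by exact_mod_cast hn
  have hq : p.HolderConjugate q :=
    Real.holderConjugate_iff.2 ⟨hp, by simpa only [one_div] using hpq⟩
  have hna : 1 ≤ (n : ℝ) * a := by rwa [div_le_iff₀' hn'] at ha
  have ha0 : 0 < a := pos_of_mul_pos_right (by linarith) hn'.le
  have hx0 : 0 < x := ha0.trans hax
  have hnx : (n : ℝ) * a < n * x := mul_lt_mul_of_pos_left hax hn'
  have hnb : (n : ℝ) * x < n * b := mul_lt_mul_of_pos_left hxb hn'
  obtain ⟨m, hm⟩ := Int.eq_ofNat_of_zero_le (Int.floor_nonneg.2 (zero_le_one.trans hna))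
  obtain ⟨M, hM⟩ := Int.eq_ofNat_of_zero_le (Int.ceil_nonneg (a := (n : ℝ) * b) (by linarith))
  have hmα : (m : ℝ) = n * α := by rw [hα, hm]; push_cast; field_simp
  have hMβ : (M : ℝ) = n * β := by rw [hβ, hM]; push_cast; field_simp
  have hm0 : 0 < m := by
    have h := Int.le_floor (z := 1).2 (by simpa using hna)
    omega
  have hma : (m : ℝ) ≤ n * a := by
    have h := Int.floor_le ((n : ℝ) * a)
    rw [hm] at h
    exact_mod_cast h
  have hbM : (n : ℝ) * b ≤ M := by
    have h := Int.le_ceil ((n : ℝ) * b)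
    rw [hM] at h
    exact_mod_cast h
  have hℓk (k : ℕ) : ℓ ((k : ℝ) / n) = c * ((k : ℝ) / n) + d := hcd _ (by positivity)
  set g : ℕ → ℝ := fun k => f ((k : ℝ) / n) - ℓ ((k : ℝ) / n) with hg
  have hg0 (k : ℕ) (h1 : m < k) (h2 : k < M) : g k = 0 := by
    refine sub_eq_zero.2 (hfℓ _ ?_ ?_)
    · rw [lt_div_iff₀' hn']
      have h := Int.floor_lt (a := (n : ℝ) * a) (z := k).1 (by omega)
      exact_mod_cast h
    · rw [div_lt_iff₀' hn']
      have h := Int.lt_ceil (a := (n : ℝ) * b) (z := k).1 (by omega)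
      exact_mod_cast h
  have hlam : 0 < (n : ℝ) * x := by positivity
  have hP := poissonProb_nonneg hlam.le
  have hgs : Summable fun k => |g k| ^ p * poissonProb (n * x) k := by
    have hs := summable_abs_affine_rpow_mul_poissonProb hlam.le (by linarith : 0 ≤ p) (c / n) d
    refine Summable.of_nonneg_of_le
      (fun k => mul_nonneg (rpow_nonneg (abs_nonneg _) _) (hP k)) (fun k => ?_)
      ((hint.add hs).mul_left (2 ^ (p - 1)))
    rw [← add_mul, ← mul_assoc, div_mul_eq_mul_div, ← mul_div_assoc', ← hℓk]
    exact mul_le_mul_of_nonneg_right (abs_sub_rpow_le hp.le _ _) (hP k)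
  obtain ⟨hs, hle⟩ := abs_tsum_mul_poissonProb_le hlam hq hm0 (hma.trans hnx.le)
    (hnb.le.trans hbM) g hg0 hgs
  have hS : szasz n f x - f x = ∑' k : ℕ, g k * poissonProb (n * x) k := by
    have h := hs.hasSum.add (hasSum_affine_mul_poissonProb hn x c d)
    have h' : (fun k : ℕ => g k * poissonProb (n * x) k +
        (c * ((k : ℝ) / n) + d) * poissonProb (n * x) k) =
        fun k : ℕ => f ((k : ℝ) / n) * poissonProb (n * x) k := by
      funext k
      rw [hg, ← hℓk]
      ring
    rw [h'] at h
    rw [szasz, h.tsum_eq, hfℓ x hax hxb, hcd x hx0.le]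
    ring
  have hα' : α ≤ x := by nlinarith
  have hβ' : x ≤ β := by nlinarith
  have hL : min ((n * x) / ((n * x - m + 1) * √(2 * π * m))) (1 / 2) + 1 / √(2 * π * m) =
      Ln n x α := by
    have e : (n : ℝ) * x - n * α + 1 = n * (x - α + 1 / n) := by field_simp
    rw [Ln, hmα, ← mul_assoc, e, mul_assoc (n : ℝ), mul_div_mul_left _ _ hn'.ne']
  have hR : min ((n * x) / ((M - n * x + 1) * √(2 * π * M))) (1 / 2) + 1 / √(2 * π * M) =
      Rn n x β := by
    have e : (n : ℝ) * β - n * x + 1 = n * (β - x + 1 / n) := by field_simp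
    rw [Rn, hMβ, ← mul_assoc, e, mul_assoc (n : ℝ), mul_div_mul_left _ _ hn'.ne']
  have hL0 : 0 ≤ Ln n x α := by
    have : 0 ≤ x - α := sub_nonneg.2 hα'
    rw [Ln]; positivity
  have hR0 : 0 ≤ Rn n x β := by
    have : 0 ≤ β - x := sub_nonneg.2 hβ'
    rw [Rn]; positivity
  rw [hL, hR, rpow_mul_exp_neg_H hn hL0 hmα, rpow_mul_exp_neg_H hn hR0 hMβ] at hle
  rw [hS]
  exact hle
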